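/- Let α ∈ (0,1). The constant a₀ = (2 ∫₀^∞ Φ(x) dx)^{−1} is well defined (the integral is finite and positive), and for every t > 0 the function x ↦ ℰ(x,t) is integrable on (0,∞) with ∫₀^∞ ℰ(x,t) dx = 1/2. -/

import Mathlib

open MeasureTheory Real Set
/-- The function `Φ(x) = Σ (−1)ⁿ bₙ (x^{1+α}/(1+α))ⁿ`, where
`bₙ = ∏_{i<n} Γ(αi+i+2)/Γ(α(i+1)+i+2)`; it equals the generalized Mittag-Leffler
function `E_{α,1+1/α,1/α}(−x^{1+α}/(1+α))`. -/
noncomputable def PhiF (α : ℝ) (x : ℝ) : ℝ :=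
  ∑' n : ℕ, (-1:ℝ)^n *
    (∏ i ∈ Finset.range n, Real.Gamma (α * i + i + 2) / Real.Gamma (α * (i+1) + i + 2)) *
    (x ^ (1+α) / (1+α)) ^ n
/-- The normalizing constant `a₀ = (2∫₀^∞ Φ)⁻¹`. -/
noncomputable def a0 (α : ℝ) : ℝ := (2 * ∫ x in Set.Ioi (0:ℝ), PhiF α x)⁻¹

/-- The fundamental solution `ℰ(x,t) = a₀ t^{−1/(1+α)} Φ(|x| t^{−1/(1+α)})` for `t > 0`,
extended by `0` for `t ≤ 0`. -/
noncomputable def fundSol (α : ℝ) (x t : ℝ) : ℝ :=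
  if 0 < t then a0 α * t ^ (-(1/(1+α))) * PhiF α (|x| * t ^ (-(1/(1+α)))) else 0

open Filter Topology

/-- The Riemann–Liouville integral of a power. -/
theorem integral_sub_rpow_mul_rpow {a b x : ℝ} (ha : 0 < a) (hb : 0 < b) (hx : 0 < x) :
    ∫ y in 0..x, (x - y) ^ (a - 1) * y ^ (b - 1) =
      Gamma a * (Gamma b / Gamma (b + a)) * x ^ (b + a - 1) := by
  have hB : Complex.betaIntegral b a = ((ProbabilityTheory.beta b a : ℝ) : ℂ) := by
    rw [ProbabilityTheory.beta, Complex.betaIntegral_eq_Gamma_mul_div _ _ (by simpa) (by simpa),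
      ← Complex.ofReal_add, Complex.Gamma_ofReal, Complex.Gamma_ofReal, Complex.Gamma_ofReal]
    norm_cast
  have h := Complex.betaIntegral_scaled b a hx
  have h' : ∫ y in 0..x, (y : ℂ) ^ ((b : ℂ) - 1) * ((x : ℂ) - y) ^ ((a : ℂ) - 1) =
      ((∫ y in 0..x, (x - y) ^ (a - 1) * y ^ (b - 1) : ℝ) : ℂ) := by
    rw [← intervalIntegral.integral_ofReal]
    refine intervalIntegral.integral_congr fun y hy ↦ ?_
    rw [uIcc_of_le hx.le] at hy
    rw [Complex.ofReal_mul, Complex.ofReal_cpow (sub_nonneg.2 hy.2), Complex.ofReal_cpow hy.1]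
    push_cast
    ring
  rw [h', hB] at h
  have hp : (x : ℂ) ^ ((b : ℂ) + a - 1) = ((x ^ (b + a - 1) : ℝ) : ℂ) := by
    rw [Complex.ofReal_cpow hx.le]
    push_cast
    rfl
  rw [hp, ← Complex.ofReal_mul, Complex.ofReal_inj] at h
  rw [h, ProbabilityTheory.beta]
  ring

theorem intervalIntegrable_sub_rpow {a x : ℝ} (ha : 0 < a) (u v : ℝ) :
    IntervalIntegrable (fun y ↦ (x - y) ^ (a - 1)) volume u v := by
  have := (intervalIntegral.intervalIntegrable_rpow' (a := x - u) (b := x - v)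
    (r := a - 1) (by linarith)).comp_sub_left x
  simpa using this

/-- Wendel's inequality for the ratio of Gamma functions. -/
theorem Gamma_div_Gamma_add_le {a z : ℝ} (ha : a ∈ Ioo (0 : ℝ) 1) (hz : 0 < z) :
    Gamma z / Gamma (z + a) ≤ (z + a) ^ (1 - a) / z := by
  have hza : 0 < z + a := add_pos hz ha.1
  have hG := Gamma_pos_of_pos hza
  have h := Gamma_mul_add_mul_le_rpow_Gamma_mul_rpow_Gamma hza (by linarith : 0 < z + a + 1)
    ha.1 (sub_pos.2 ha.2) (by ring)
  rw [show a * (z + a) + (1 - a) * (z + a + 1) = z + 1 by ring, Gamma_add_one hz.ne',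
    Gamma_add_one hza.ne', mul_rpow hza.le hG.le, mul_left_comm, ← rpow_add hG] at h
  rw [div_le_div_iff₀ hG hz]
  simpa [mul_comm] using h

theorem tendsto_Gamma_div_Gamma_add {a : ℝ} (ha : a ∈ Ioo (0 : ℝ) 1) :
    Tendsto (fun z ↦ Gamma z / Gamma (z + a)) atTop (𝓝 0) := by
  have h2 : Tendsto (fun z : ℝ ↦ 2 * z ^ (-a)) atTop (𝓝 0) := by
    simpa using (tendsto_rpow_neg_atTop ha.1).const_mul 2
  refine tendsto_of_tendsto_of_tendsto_of_le_of_le' tendsto_const_nhds h2 ?_ ?_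
  · filter_upwards [eventually_gt_atTop 0] with z hz
    exact div_nonneg (Gamma_pos_of_pos hz).le (Gamma_pos_of_pos (add_pos hz ha.1)).le
  · filter_upwards [eventually_ge_atTop 1] with z hz
    have hz0 : 0 < z := by linarith
    refine (Gamma_div_Gamma_add_le ha hz0).trans ?_
    have h3 : (z + a) ^ (1 - a) ≤ 2 * z ^ (1 - a) := by
      calc (z + a) ^ (1 - a) ≤ (2 * z) ^ (1 - a) :=
            rpow_le_rpow (by linarith [ha.1]) (by linarith [ha.2]) (by linarith [ha.2])
        _ = 2 ^ (1 - a) * z ^ (1 - a) := mul_rpow (by norm_num) hz0.le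
        _ ≤ 2 ^ (1 : ℝ) * z ^ (1 - a) := by
            gcongr
            · norm_num
            · linarith [ha.1]
        _ = 2 * z ^ (1 - a) := by rw [rpow_one]
    rw [div_le_iff₀ hz0, mul_assoc, ← rpow_add_one hz0.ne']
    rwa [neg_add_eq_sub]

/-- The coefficients of `Φ` as a power series in `x ^ (1 + α)`. -/
noncomputable def phiCoeff (α : ℝ) (n : ℕ) : ℝ :=
  (-1 : ℝ) ^ n *
    (∏ i ∈ Finset.range n, Gamma (α * i + i + 2) / Gamma (α * (i + 1) + i + 2)) / (1 + α) ^ n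

/-- The entire function `F` with `Φ(x) = F(x ^ (1 + α))`. -/
noncomputable def phiSeries (α w : ℝ) : ℝ := ∑' n, phiCoeff α n * w ^ n

theorem PhiF_eq_phiSeries (α x : ℝ) : PhiF α x = phiSeries α (x ^ (1 + α)) := by
  refine tsum_congr fun n ↦ ?_
  rw [phiCoeff, div_pow]
  ring

theorem phiCoeff_zero (α : ℝ) : phiCoeff α 0 = 1 := by simp [phiCoeff]

theorem phiCoeff_succ (α : ℝ) (n : ℕ) :
    phiCoeff α (n + 1) = -(phiCoeff α n *
      (Gamma ((1 + α) * n + 2) / Gamma ((1 + α) * n + 2 + α)) / (1 + α)) := by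
  rw [phiCoeff, phiCoeff, Finset.prod_range_succ, pow_succ, pow_succ,
    show α * n + n + 2 = (1 + α) * n + 2 by ring,
    show α * (n + 1) + n + 2 = (1 + α) * n + 2 + α by ring]
  simp only [div_eq_mul_inv, mul_inv]
  ring

theorem phiCoeff_ne_zero {α : ℝ} (hα : 0 < α) (n : ℕ) : phiCoeff α n ≠ 0 := by
  refine div_ne_zero (mul_ne_zero (pow_ne_zero _ (by norm_num))
    (Finset.prod_ne_zero_iff.2 fun i _ ↦ ?_)) (by positivity)
  exact div_ne_zero (Gamma_pos_of_pos (by positivity)).ne' (Gamma_pos_of_pos (by positivity)).ne'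

theorem phiCoeff_radius {α : ℝ} (hα : α ∈ Ioo (0 : ℝ) 1) :
    (FormalMultilinearSeries.ofScalars ℝ (phiCoeff α)).radius = ⊤ := by
  have h1 : 0 < 1 + α := by linarith [hα.1]
  refine FormalMultilinearSeries.ofScalars_radius_eq_top_of_tendsto _ _
    (.of_forall (phiCoeff_ne_zero hα.1)) ?_
  have ht : Tendsto (fun n : ℕ ↦ (1 + α) * (n : ℝ) + 2) atTop atTop :=
    tendsto_atTop_add_const_right _ _ (tendsto_natCast_atTop_atTop.const_mul_atTop h1)
  have h := (((tendsto_Gamma_div_Gamma_add hα).comp ht).div_const (1 + α)).norm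
  simp only [zero_div, norm_zero] at h
  refine h.congr fun n ↦ ?_
  have hn : ‖phiCoeff α n‖ ≠ 0 := norm_ne_zero_iff.2 (phiCoeff_ne_zero hα.1 n)
  rw [Nat.succ_eq_add_one, phiCoeff_succ, norm_neg, mul_div_assoc, norm_mul,
    mul_div_cancel_left₀ _ hn]
  rfl

theorem phiSeries_hasFPowerSeriesOnBall {α : ℝ} (hα : α ∈ Ioo (0 : ℝ) 1) :
    HasFPowerSeriesOnBall (phiSeries α) (FormalMultilinearSeries.ofScalars ℝ (phiCoeff α)) 0 ⊤ := by
  have h := (FormalMultilinearSeries.ofScalars ℝ (phiCoeff α)).hasFPowerSeriesOnBall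
    (by simp [phiCoeff_radius hα])
  rw [phiCoeff_radius hα] at h
  convert h using 1
  funext w
  exact (FormalMultilinearSeries.ofScalars_sum_eq (phiCoeff α) w).symm

theorem phiSeries_analyticOnNhd {α : ℝ} (hα : α ∈ Ioo (0 : ℝ) 1) :
    AnalyticOnNhd ℝ (phiSeries α) univ := by
  simpa using (phiSeries_hasFPowerSeriesOnBall hα).analyticOnNhd

theorem summable_phiSeries {α : ℝ} (hα : α ∈ Ioo (0 : ℝ) 1) (w : ℝ) :
    Summable fun n ↦ phiCoeff α n * w ^ n := by
  simpa [mul_comm] using ((phiSeries_hasFPowerSeriesOnBall hα).hasSum (y := w) (by simp)).summable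

theorem continuous_PhiF {α : ℝ} (hα : α ∈ Ioo (0 : ℝ) 1) : Continuous (PhiF α) := by
  have h := (phiSeries_analyticOnNhd hα).continuousOn.comp_continuous
    (continuous_id.rpow_const fun x ↦ Or.inr (by linarith [hα.1] : (0 : ℝ) ≤ 1 + α))
    fun _ ↦ mem_univ _
  exact h.congr fun x ↦ (PhiF_eq_phiSeries α x).symm

theorem phiSeries_zero (α : ℝ) : phiSeries α 0 = 1 := by
  rw [phiSeries, tsum_eq_single 0 (fun n hn ↦ by simp [hn])]
  simp [phiCoeff_zero]

theorem PhiF_zero {α : ℝ} (hα : 0 < α) : PhiF α 0 = 1 := by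
  rw [PhiF_eq_phiSeries, zero_rpow (by linarith), phiSeries_zero]

theorem intervalIntegrable_kernel_mul_PhiF {α : ℝ} (hα : α ∈ Ioo (0 : ℝ) 1) (x u v : ℝ) :
    IntervalIntegrable (fun y ↦ (x - y) ^ (α - 1) * (y * PhiF α y)) volume u v :=
  (intervalIntegrable_sub_rpow hα.1 u v).mul_continuousOn
    (continuous_id.mul (continuous_PhiF hα)).continuousOn

/-- `Φ` solves the Volterra equation `I^α (x Φ) = (1 + α) (1 - Φ)`. -/
theorem integral_kernel_mul_PhiF {α : ℝ} (hα : α ∈ Ioo (0 : ℝ) 1) {x : ℝ} (hx : 0 < x) :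
    ∫ y in 0..x, (x - y) ^ (α - 1) * (y * PhiF α y) =
      (1 + α) * Gamma α * (1 - PhiF α x) := by
  have h1 : 0 < 1 + α := by linarith [hα.1]
  set K : ℝ → ℕ → ℝ → ℝ := fun c n y ↦ c * ((x - y) ^ (α - 1) * y ^ ((1 + α) * n + 2 - 1)) with hK
  have hKi (c : ℝ) (n : ℕ) : IntegrableOn (K c n) (Ioc 0 x) := by
    rw [← intervalIntegrable_iff_integrableOn_Ioc_of_le hx.le]
    refine ((intervalIntegrable_sub_rpow hα.1 0 x).mul_continuousOn ?_).const_mul c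
    refine (continuous_id.rpow_const fun y ↦ Or.inr ?_).continuousOn
    have : 0 ≤ (1 + α) * n := by positivity
    linarith
  have hKint (n : ℕ) : ∫ y in Ioc 0 x, K (phiCoeff α n) n y =
      -((1 + α) * Gamma α) * (phiCoeff α (n + 1) * (x ^ (1 + α)) ^ (n + 1)) := by
    rw [← intervalIntegral.integral_of_le hx.le, intervalIntegral.integral_const_mul,
      integral_sub_rpow_mul_rpow hα.1 (by positivity) hx, phiCoeff_succ, ← rpow_mul_natCast hx.le]
    rw [show (1 + α) * ((n + 1 : ℕ) : ℝ) = (1 + α) * n + 2 + α - 1 by push_cast; ring]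
    field_simp
  have hnorm (n : ℕ) : ∫ y in Ioc 0 x, ‖K (phiCoeff α n) n y‖ =
      (1 + α) * Gamma α * ‖phiCoeff α (n + 1) * (x ^ (1 + α)) ^ (n + 1)‖ := by
    have hG : 0 < Gamma α := Gamma_pos_of_pos hα.1
    rw [show (1 + α) * Gamma α * ‖phiCoeff α (n + 1) * (x ^ (1 + α)) ^ (n + 1)‖ =
      ‖-((1 + α) * Gamma α) * (phiCoeff α (n + 1) * (x ^ (1 + α)) ^ (n + 1))‖ by
        rw [norm_mul (-_), norm_neg, norm_of_nonneg (by positivity : 0 ≤ (1 + α) * Gamma α)], ← hKint]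
    simp only [hK, norm_mul, integral_const_mul]
    congr 1
    rw [norm_of_nonneg]
    · refine setIntegral_congr_fun measurableSet_Ioc fun y hy ↦ ?_
      rw [norm_of_nonneg (rpow_nonneg (sub_nonneg.2 hy.2) _), norm_of_nonneg (rpow_nonneg hy.1.le _)]
    · exact setIntegral_nonneg measurableSet_Ioc fun y hy ↦
        mul_nonneg (rpow_nonneg (sub_nonneg.2 hy.2) _) (rpow_nonneg hy.1.le _)
  have hs := summable_phiSeries hα (x ^ (1 + α))
  have hsum := hasSum_integral_of_summable_integral_norm
    (μ := volume.restrict (Ioc 0 x)) (F := fun n ↦ K (phiCoeff α n) n) (fun n ↦ hKi _ n) (by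
      simp only [hnorm]
      exact ((summable_nat_add_iff 1).2 hs.norm).mul_left _)
  simp only [hKint] at hsum
  have hL : ∫ y in Ioc 0 x, ∑' n, K (phiCoeff α n) n y =
      ∫ y in 0..x, (x - y) ^ (α - 1) * (y * PhiF α y) := by
    rw [intervalIntegral.integral_of_le hx.le]
    refine setIntegral_congr_fun measurableSet_Ioc fun y hy ↦ ?_
    simp only [PhiF_eq_phiSeries, phiSeries, hK, ← tsum_mul_left]
    refine tsum_congr fun n ↦ ?_
    rw [show (1 + α) * (n : ℝ) + 2 - 1 = (1 + α) * n + 1 by ring, rpow_add_one hy.1.ne',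
      rpow_mul_natCast hy.1.le]
    ring
  have hPhi : PhiF α x = 1 + ∑' n, phiCoeff α (n + 1) * (x ^ (1 + α)) ^ (n + 1) := by
    rw [PhiF_eq_phiSeries, phiSeries, hs.tsum_eq_zero_add, phiCoeff_zero]
    simp
  rw [← hL, ← hsum.tsum_eq, tsum_mul_left, hPhi]
  ring

theorem eventually_PhiF_ne_zero {α : ℝ} (hα : α ∈ Ioo (0 : ℝ) 1) {x₀ : ℝ} (hx₀ : 0 < x₀) :
    ∀ᶠ x in 𝓝[>] x₀, PhiF α x ≠ 0 := by
  have h1 : 0 < 1 + α := by linarith [hα.1]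
  have hF : ∀ᶠ w in 𝓝[≠] (x₀ ^ (1 + α)), phiSeries α w ≠ 0 := by
    refine ((phiSeries_analyticOnNhd hα) _ (mem_univ _)).eventually_eq_zero_or_eventually_ne_zero
      |>.resolve_left fun h ↦ ?_
    have := (phiSeries_analyticOnNhd hα).eqOn_zero_of_preconnected_of_eventuallyEq_zero
      isPreconnected_univ (mem_univ _) h (mem_univ 0)
    simp [phiSeries_zero] at this
  have ht : Tendsto (fun x : ℝ ↦ x ^ (1 + α)) (𝓝[>] x₀) (𝓝[≠] (x₀ ^ (1 + α))) := by
    refine tendsto_nhdsWithin_of_tendsto_nhds_of_eventually_within _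
      ((continuousAt_rpow_const _ _ (Or.inl hx₀.ne')).tendsto.mono_left nhdsWithin_le_nhds) ?_
    filter_upwards [self_mem_nhdsWithin] with x hx
    exact (rpow_lt_rpow hx₀.le hx h1).ne'
  simpa only [PhiF_eq_phiSeries] using ht.eventually hF

theorem PhiF_nonneg {α : ℝ} (hα : α ∈ Ioo (0 : ℝ) 1) {x : ℝ} (hx : 0 ≤ x) : 0 ≤ PhiF α x := by
  by_contra! hneg
  have hc := continuous_PhiF hα
  set A : Set ℝ := {y | 0 ≤ y ∧ PhiF α y < 0} with hA
  have hne : A.Nonempty := ⟨x, hx, hneg⟩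
  have hbdd : BddBelow A := ⟨0, fun y hy ↦ hy.1⟩
  set x₀ := sInf A with hx₀
  have hx₀nn : 0 ≤ x₀ := le_csInf hne fun y hy ↦ hy.1
  have hle : PhiF α x₀ ≤ 0 :=
    closure_minimal (t := {y | PhiF α y ≤ 0}) (fun y hy ↦ hy.2.le)
      (isClosed_le hc continuous_const) (csInf_mem_closure hne hbdd)
  have hpos : 0 < x₀ := hx₀nn.lt_of_ne fun h ↦ by
    rw [← h, PhiF_zero hα.1] at hle
    linarith
  have hbefore : ∀ y, 0 ≤ y → y < x₀ → 0 ≤ PhiF α y := fun y hy hyx ↦ by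
    by_contra! h
    exact notMem_of_lt_csInf hyx hbdd ⟨hy, h⟩
  have hge : 0 ≤ PhiF α x₀ := by
    refine ge_of_tendsto (hc.continuousAt.tendsto.mono_left nhdsWithin_le_nhds :
      Tendsto (PhiF α) (𝓝[<] x₀) _) ?_
    filter_upwards [Ioo_mem_nhdsLT hpos] with y hy using hbefore y hy.1.le hy.2
  have hzero : PhiF α x₀ = 0 := le_antisymm hle hge
  obtain ⟨u, hu, hnz⟩ := mem_nhdsGT_iff_exists_Ioo_subset.1 (eventually_PhiF_ne_zero hα hpos)
  obtain ⟨x₁, hx₁, hx₁u⟩ := exists_lt_of_csInf_lt hne (show sInf A < u from hu)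
  have h01 : x₀ < x₁ := (csInf_le hbdd hx₁).lt_of_ne fun h ↦ by
    have := hx₁.2
    rw [← h, ← hx₀, hzero] at this
    exact this.false
  have hafter : ∀ y ∈ Ioo x₀ x₁, PhiF α y ≤ 0 := fun y hy ↦ by
    by_contra! h
    obtain ⟨z, hz, hz0⟩ := intermediate_value_Icc' hy.2.le hc.continuousOn ⟨hx₁.2.le, h.le⟩
    exact hnz ⟨hy.1.trans_le hz.1, hz.2.trans_lt hx₁u⟩ hz0
  have hV₀ := integral_kernel_mul_PhiF hα hpos
  have hV₁ := integral_kernel_mul_PhiF hα (hpos.trans h01)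
  rw [← intervalIntegral.integral_add_adjacent_intervals
    (intervalIntegrable_kernel_mul_PhiF hα x₁ 0 x₀)
    (intervalIntegrable_kernel_mul_PhiF hα x₁ x₀ x₁)] at hV₁
  have hI₁ : ∫ y in 0..x₀, (x₁ - y) ^ (α - 1) * (y * PhiF α y) ≤
      ∫ y in 0..x₀, (x₀ - y) ^ (α - 1) * (y * PhiF α y) := by
    refine intervalIntegral.integral_mono_on_of_le_Ioo hpos.le
      (intervalIntegrable_kernel_mul_PhiF hα _ _ _)
      (intervalIntegrable_kernel_mul_PhiF hα _ _ _) fun y hy ↦ ?_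
    refine mul_le_mul_of_nonneg_right ?_ (mul_nonneg hy.1.le (hbefore y hy.1.le hy.2))
    exact rpow_le_rpow_of_nonpos (sub_pos.2 hy.2) (by linarith) (by linarith [hα.2])
  have hI₂ : ∫ y in x₀..x₁, (x₁ - y) ^ (α - 1) * (y * PhiF α y) ≤ ∫ _ in x₀..x₁, (0 : ℝ) := by
    refine intervalIntegral.integral_mono_on_of_le_Ioo h01.le
      (intervalIntegrable_kernel_mul_PhiF hα _ _ _) intervalIntegrable_const fun y hy ↦ ?_
    exact mul_nonpos_of_nonneg_of_nonpos (rpow_nonneg (sub_pos.2 hy.2).le _)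
      (mul_nonpos_of_nonneg_of_nonpos (hpos.trans hy.1).le (hafter y hy))
  rw [intervalIntegral.integral_zero] at hI₂
  have hC : 0 < (1 + α) * Gamma α := mul_pos (by linarith [hα.1]) (Gamma_pos_of_pos hα.1)
  rw [hzero] at hV₀
  nlinarith [mul_neg_of_pos_of_neg hC hx₁.2]

theorem integral_mul_PhiF_le {α : ℝ} (hα : α ∈ Ioo (0 : ℝ) 1) {x : ℝ} (hx : 0 < x) :
    ∫ y in 0..x, y * PhiF α y ≤ (1 + α) * Gamma α * x ^ (1 - α) := by
  have hc := continuous_PhiF hα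
  have h : ∫ y in 0..x, x ^ (α - 1) * (y * PhiF α y) ≤
      ∫ y in 0..x, (x - y) ^ (α - 1) * (y * PhiF α y) := by
    refine intervalIntegral.integral_mono_on_of_le_Ioo hx.le
      (Continuous.intervalIntegrable (by fun_prop) _ _)
      (intervalIntegrable_kernel_mul_PhiF hα _ _ _) fun y hy ↦ ?_
    refine mul_le_mul_of_nonneg_right ?_ (mul_nonneg hy.1.le (PhiF_nonneg hα hy.1.le))
    exact rpow_le_rpow_of_nonpos (sub_pos.2 hy.2) (by linarith [hy.1]) (by linarith [hα.2])
  have hC : 0 < (1 + α) * Gamma α := mul_pos (by linarith [hα.1]) (Gamma_pos_of_pos hα.1)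
  rw [intervalIntegral.integral_const_mul, integral_kernel_mul_PhiF hα hx,
    ← neg_sub 1 α, rpow_neg hx.le, inv_mul_le_iff₀ (by positivity)] at h
  have := mul_nonneg hC.le (PhiF_nonneg hα hx.le)
  have hxp := rpow_nonneg hx.le (1 - α)
  nlinarith [mul_nonneg hxp this]

theorem integral_PhiF_doubling_le {α : ℝ} (hα : α ∈ Ioo (0 : ℝ) 1) {r : ℝ} (hr : 0 < r) :
    ∫ y in r..2 * r, PhiF α y ≤ 2 ^ (1 - α) * ((1 + α) * Gamma α) * r ^ (-α) := by
  have hc := continuous_PhiF hα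
  have hi (u v : ℝ) : IntervalIntegrable (fun y ↦ y * PhiF α y) volume u v :=
    Continuous.intervalIntegrable (by fun_prop) _ _
  have h₁ : ∫ y in r..2 * r, r * PhiF α y ≤ ∫ y in r..2 * r, y * PhiF α y :=
    intervalIntegral.integral_mono_on (by linarith)
      (Continuous.intervalIntegrable (by fun_prop) _ _) (hi _ _) fun y hy ↦
        mul_le_mul_of_nonneg_right hy.1 (PhiF_nonneg hα (hr.le.trans hy.1))
  have h₂ : 0 ≤ ∫ y in 0..r, y * PhiF α y :=
    intervalIntegral.integral_nonneg hr.le fun y hy ↦ mul_nonneg hy.1 (PhiF_nonneg hα hy.1)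
  have h₃ := integral_mul_PhiF_le hα (by linarith : 0 < 2 * r)
  rw [← intervalIntegral.integral_add_adjacent_intervals (hi 0 r) (hi r (2 * r)),
    mul_rpow zero_le_two hr.le, show 1 - α = -α + 1 by ring, rpow_add_one hr.ne'] at h₃
  rw [intervalIntegral.integral_const_mul] at h₁
  rw [show 1 - α = -α + 1 by ring]
  refine le_of_mul_le_mul_left ?_ hr
  linarith

theorem integrableOn_PhiF {α : ℝ} (hα : α ∈ Ioo (0 : ℝ) 1) : IntegrableOn (PhiF α) (Ioi 0) := by
  have hc := continuous_PhiF hα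
  set q : ℝ := 2 ^ (-α) with hq
  have hq1 : q < 1 := rpow_lt_one_of_one_lt_of_neg one_lt_two (by linarith [hα.1])
  have hq0 : 0 < q := by positivity
  set M : ℝ := 2 ^ (1 - α) * ((1 + α) * Gamma α)
  have hM : 0 < M := by
    have := Gamma_pos_of_pos hα.1
    have := hα.1
    positivity
  set I₀ := ∫ y in (0 : ℝ)..1, PhiF α y
  have key (n : ℕ) : ∫ y in (0 : ℝ)..2 ^ n, PhiF α y ≤ I₀ + M / (1 - q) * (1 - q ^ n) := by
    induction n with
    | zero => simp [I₀]
    | succ n ih =>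
      have hd := integral_PhiF_doubling_le hα (r := 2 ^ n) (by positivity)
      rw [← rpow_natCast, ← rpow_mul zero_le_two, mul_comm (n : ℝ), rpow_mul zero_le_two,
        rpow_natCast, rpow_natCast, ← hq, ← pow_succ'] at hd
      rw [← intervalIntegral.integral_add_adjacent_intervals
        (hc.intervalIntegrable 0 (2 ^ n)) (hc.intervalIntegrable (2 ^ n) (2 ^ (n + 1)))]
      have he : M / (1 - q) * (1 - q ^ (n + 1)) = M / (1 - q) * (1 - q ^ n) + M * q ^ n := by
        have : 1 - q ≠ 0 := by linarith
        field_simp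
        ring
      linarith
  refine integrableOn_Ioi_of_intervalIntegral_norm_bounded (l := atTop) (I₀ + M / (1 - q)) 0
    (b := fun n : ℕ ↦ (2 : ℝ) ^ n) (fun n ↦ (hc.integrableOn_Icc).mono_set Ioc_subset_Icc_self)
    (tendsto_pow_atTop_atTop_of_one_lt one_lt_two) (.of_forall fun n ↦ ?_)
  have hn : ∫ y in (0 : ℝ)..2 ^ n, ‖PhiF α y‖ = ∫ y in (0 : ℝ)..2 ^ n, PhiF α y := by
    refine intervalIntegral.integral_congr fun y hy ↦ ?_
    rw [uIcc_of_le (by positivity)] at hy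
    exact norm_of_nonneg (PhiF_nonneg hα hy.1)
  rw [hn]
  refine (key n).trans ?_
  have : 0 ≤ M / (1 - q) * q ^ n :=
    mul_nonneg (div_nonneg hM.le (by linarith)) (by positivity)
  linarith

theorem integral_PhiF_pos {α : ℝ} (hα : α ∈ Ioo (0 : ℝ) 1) : 0 < ∫ x in Ioi (0 : ℝ), PhiF α x := by
  have hc := continuous_PhiF hα
  have h₁ : 0 < ∫ x in (0 : ℝ)..1, PhiF α x :=
    intervalIntegral.integral_pos zero_lt_one hc.continuousOn
      (fun y hy ↦ PhiF_nonneg hα hy.1.le) ⟨0, by simp, by simp [PhiF_zero hα.1]⟩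
  refine h₁.trans_le ?_
  rw [intervalIntegral.integral_of_le zero_le_one]
  refine setIntegral_mono_set (integrableOn_PhiF hα) ?_ Ioc_subset_Ioi_self.eventuallyLE
  filter_upwards [ae_restrict_mem measurableSet_Ioi] with y hy
  exact PhiF_nonneg hα (le_of_lt hy)

theorem fundSol_eqOn (α : ℝ) {t : ℝ} (ht : 0 < t) :
    EqOn (fun x ↦ fundSol α x t)
      (fun x ↦ a0 α * t ^ (-(1 / (1 + α))) * PhiF α (x * t ^ (-(1 / (1 + α))))) (Ioi 0) :=
  fun x hx ↦ by simp only [fundSol, if_pos ht, abs_of_pos (mem_Ioi.1 hx)]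

/-- the constant `a₀` is well defined (the integral of `Φ` over `(0,∞)`
is finite and positive), and for every `t > 0` the function `x ↦ ℰ(x,t)` is
integrable on `(0,∞)` with `∫₀^∞ ℰ(x,t) dx = 1/2`. -/
theorem fundSol_mass (α : ℝ) (hα : α ∈ Set.Ioo (0:ℝ) 1) :
    IntegrableOn (PhiF α) (Set.Ioi 0) ∧
    (0 < ∫ x in Set.Ioi (0:ℝ), PhiF α x) ∧
    ∀ t > (0:ℝ), IntegrableOn (fun x => fundSol α x t) (Set.Ioi 0) ∧
      ∫ x in Set.Ioi (0:ℝ), fundSol α x t = 1/2 := by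
  refine ⟨integrableOn_PhiF hα, integral_PhiF_pos hα, fun t ht ↦ ?_⟩
  have hc : 0 < t ^ (-(1 / (1 + α))) := rpow_pos_of_pos ht _
  refine ⟨?_, ?_⟩
  · rw [integrableOn_congr_fun (fundSol_eqOn α ht) measurableSet_Ioi]
    refine Integrable.const_mul ?_ _
    refine (integrableOn_Ioi_comp_mul_right_iff (PhiF α) 0 hc).2 ?_
    simpa using integrableOn_PhiF hα
  · rw [setIntegral_congr_fun measurableSet_Ioi (fundSol_eqOn α ht), integral_const_mul,
      integral_comp_mul_right_Ioi (PhiF α) 0 hc, zero_mul, a0, smul_eq_mul]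
    have := (integral_PhiF_pos hα).ne'
    field_simp
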